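/- Let b be a rational number with b ≠ −1 and set c = 1. Then D(b,1) = 1 + b ≠ 0, K(b,1) = 1 ≠ 0, and for all rational x and d the identities 2(1 + b)²·P(x) = x·(2(1 + b)²x² − (2b + 2)x − b(b + 2)) and 2(1 + b)²·Q(d) = (d + 1)·(2(1 + b)²d² − (2b + 2)d − b(b + 2)) hold; in particular both cubic polynomials P and Q are reducible over ℚ. -/

import Mathlib

noncomputable section

/-- The common denominator `D(b,c)`. -/
def Dd (b c : ℚ) : ℚ := b^2*c^2 + 2*b^2 - 3*b^2*c + c - b*c^2 + 2*b

/-- The quantity `K(b,c)`. -/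
def Kk (b c : ℚ) : ℚ := b^2*c^4 - 6*b^2*c^3 + 13*b^2*c^2 - 12*b^2*c + 4*b^2 + c^2

def E10 (b c : ℚ) : ℚ := -(b^2*c^2 + 2*b^2 - 3*b^2*c - c) / Dd b c

def E20 (b c : ℚ) : ℚ :=
  (b/2)*(b*c^2 - 2*c - 2*b)*(2*b*c^2 - c^2 - 6*b*c + 2 + 4*b) / (Dd b c)^2

def E30 (b c : ℚ) : ℚ :=
  b^2*c*(1 - c)*(c - 2)*(b*c^2 - 4*b*c + 2 + 4*b)*(2*b*c^2 - c^2 - 4*b*c + 2*b)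
    / (Kk b c * (Dd b c)^2)

def E01 (b c : ℚ) : ℚ := -(b*(c^2 + 2 - 2*c)) / Dd b c

def E02 (b c : ℚ) : ℚ :=
  (1/2)*(28*b^2*c^2 - 16*b^2*c - 2*c^2 - 4*b^2 - b^2*c^4 + 4*b^3*c^4 - 12*b^3*c^3
    + 4*b*c^3 + 24*b^3*c - 8*b*c - 2*b^4*c^4 + 12*b^4*c^3 - 26*b^4*c^2 - 8*b^2*c^3
    + 24*b^4*c - 16*b^3 - 8*b^4) / (Dd b c)^2

def E03 (b c : ℚ) : ℚ :=
  (b/2)*(b^2*c^4 - 5*b^2*c^3 + 10*b^2*c^2 - 10*b^2*c + 4*b^2 + 2*b*c + 2*c^2 - b*c^3)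
    *(2*b^2*c^4 - 12*b^2*c^3 + 26*b^2*c^2 - 24*b^2*c + 8*b^2 - b*c^4 + 3*b*c^3
      - 6*b*c + 4*b + c^3 - 2*c^2 + 2*c) / (Kk b c * (Dd b c)^2)

/-- The first cubic polynomial, evaluated at `x`. -/
def P (b c x : ℚ) : ℚ := x^3 - E10 b c * x^2 + E20 b c * x - E30 b c

/-- The second cubic polynomial, evaluated at `d`. -/
def Q (b c d : ℚ) : ℚ := d^3 - E01 b c * d^2 + E02 b c * d - E03 b c

open Polynomial in
/-- The first cubic as a polynomial over `ℚ`. -/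
def Ppoly (b c : ℚ) : Polynomial ℚ :=
  X^3 - C (E10 b c) * X^2 + C (E20 b c) * X - C (E30 b c)

open Polynomial in
/-- The second cubic as a polynomial over `ℚ`. -/
def Qpoly (b c : ℚ) : Polynomial ℚ :=
  X^3 - C (E01 b c) * X^2 + C (E02 b c) * X - C (E03 b c)

/-- The rational perfect cuboid equations with unit space diagonal. -/
def CuboidEqs (x1 x2 x3 d1 d2 d3 : ℚ) : Prop :=
  x1^2 + x2^2 + x3^2 = 1 ∧ x2^2 + x3^2 = d1^2 ∧ x3^2 + x1^2 = d2^2 ∧ x1^2 + x2^2 = d3^2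

/-- The auxiliary equations with prescribed right-hand sides `E21`, `E11`, `E12`. -/
def AuxEqs (x1 x2 x3 d1 d2 d3 E21 E11 E12 : ℚ) : Prop :=
  x1*x2*d3 + x2*x3*d1 + x3*x1*d2 = E21 ∧
  x1*d2 + d1*x2 + x2*d3 + d2*x3 + x3*d1 + d3*x1 = E11 ∧
  x1*d2*d3 + x2*d3*d1 + x3*d1*d2 = E12

open Polynomial in
theorem not_irreducible_cubic_of_root {K : Type*} [Field K] {p q r t : K}
    (h : t^3 - p * t^2 + q * t - r = 0) :
    ¬ Irreducible (X^3 - C p * X^2 + C q * X - C r : K[X]) := by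
  intro hirr
  have hroot : (X^3 - C p * X^2 + C q * X - C r : K[X]).IsRoot t := by
    simpa [IsRoot.def] using h
  have hone := degree_eq_one_of_irreducible_of_root hirr hroot
  have hthree : (X^3 - C p * X^2 + C q * X - C r : K[X]).degree = 3 := by
    compute_degree!
  rw [hthree] at hone
  norm_num at hone

/-- The third reducibility case `c = 1`. -/
theorem stmt4 (b : ℚ) (hb : b ≠ -1) :
    Dd b 1 = 1 + b ∧ Dd b 1 ≠ 0 ∧ Kk b 1 = 1 ∧ (1 : ℚ) ≠ 0 ∧
    (∀ x : ℚ, 2 * (1 + b)^2 * P b 1 x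
      = x * (2 * (1 + b)^2 * x^2 - (2*b + 2) * x - b * (b + 2))) ∧
    (∀ d : ℚ, 2 * (1 + b)^2 * Q b 1 d
      = (d + 1) * (2 * (1 + b)^2 * d^2 - (2*b + 2) * d - b * (b + 2))) ∧
    ¬ Irreducible (Ppoly b 1) ∧ ¬ Irreducible (Qpoly b 1) := by
  have hb' : (1 + b) ≠ 0 := fun h => hb (by linarith)
  have hD : Dd b 1 = 1 + b := by unfold Dd; ring
  have hK : Kk b 1 = 1 := by unfold Kk; ring
  have hP : ∀ x : ℚ, 2 * (1 + b)^2 * P b 1 x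
      = x * (2 * (1 + b)^2 * x^2 - (2*b + 2) * x - b * (b + 2)) := by
    intro x
    unfold P E10 E20 E30
    rw [hD, hK]
    field_simp
    ring
  have hQ : ∀ d : ℚ, 2 * (1 + b)^2 * Q b 1 d
      = (d + 1) * (2 * (1 + b)^2 * d^2 - (2*b + 2) * d - b * (b + 2)) := by
    intro d
    unfold Q E01 E02 E03
    rw [hD, hK]
    field_simp
    ring
  have hne : 2 * (1 + b)^2 ≠ 0 := by positivity
  have hP0 : P b 1 0 = 0 := (mul_eq_zero.mp ((hP 0).trans (by ring))).resolve_left hne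
  have hQ0 : Q b 1 (-1) = 0 := (mul_eq_zero.mp ((hQ (-1)).trans (by ring))).resolve_left hne
  exact ⟨hD, hD ▸ hb', hK, one_ne_zero, hP, hQ,
    not_irreducible_cubic_of_root hP0, not_irreducible_cubic_of_root hQ0⟩

end
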